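/- arXiv:dg-ga/9709013 — 2 statements merged into one kernel-verified Lean document; each statement's English description precedes it below -/
import Mathlib

section
/- Let Δ be the open unit disc in ℂ centered at 0 and Δ̄ its closure. Let k be a positive integer, let ε ∈ (0,1), and let W₁ be an open neighborhood of Δ̄ in ℂ. Suppose f : W₁ ∖ {0} → ℂ is a C^∞ function for which there is a constant C ≥ 0 with |f(z)| ≤ C·|z|^{ε−k} for all z ∈ W₁ ∖ {0}. Then there exist an open neighborhood W₂ of Δ̄ with W₂ ⊆ W₁, a C^∞ function g : W₂ ∖ {0} → ℂ, and a constant C′ ≥ 0 such that ∂g/∂z̄ = f on W₂ ∖ {0} and |g(z)| ≤ C′·|z|^{ε−k+1} for all z ∈ W₂ ∖ {0}. -/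
/-- The Wirtinger derivative with respect to `z̄`: for `g : ℂ → ℂ`, writing `z = x + iy`,
`∂g/∂z̄ = (1/2)(∂g/∂x + i·∂g/∂y)`, expressed via the real Fréchet derivative. -/
noncomputable def wirtingerBar (g : ℂ → ℂ) (z : ℂ) : ℂ :=
  (1 / 2 : ℂ) * (fderiv ℝ g z 1 + Complex.I * fderiv ℝ g z Complex.I)

open MeasureTheory Filter Topology Set Complex Metric

/-- The derivative of `h` in the direction `c * exp (iθ)` is integrable in polar coordinates
with respect to `dr dθ`. -/
lemma integrableOn_fderiv_polar {h : ℂ → ℂ} (hh : ContDiff ℝ 1 h) (hc : HasCompactSupport h)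
    (c : ℂ) :
    IntegrableOn (fun p : ℝ × ℝ ↦ fderiv ℝ h (p.1 * exp (p.2 * I)) (c * exp (p.2 * I)))
      (Ioi 0 ×ˢ Ioo (-Real.pi) Real.pi) := by
  obtain ⟨R, hR⟩ := (hc.fderiv (𝕜 := ℝ)).isCompact.isBounded.subset_closedBall 0
  have hcont : Continuous fun p : ℝ × ℝ ↦
      fderiv ℝ h (p.1 * exp (p.2 * I)) (c * exp (p.2 * I)) := by
    have := hh.continuous_fderiv one_ne_zero
    fun_prop
  refine IntegrableOn.of_forall_sdiff_eq_zero
    (s := Icc (0 : ℝ) R ×ˢ Icc (-Real.pi) Real.pi)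
    (hcont.continuousOn.integrableOn_compact (isCompact_Icc.prod isCompact_Icc))
    (measurableSet_Ioi.prod measurableSet_Ioo) ?_
  rintro ⟨r, θ⟩ ⟨⟨hr, hθ⟩, hn⟩
  have hr : 0 < r := hr
  have : fderiv ℝ h (r * exp (θ * I)) = 0 := by
    apply image_eq_zero_of_notMem_tsupport
    intro hm
    have := hR hm
    rw [mem_closedBall_zero_iff, norm_mul, norm_exp_ofReal_mul_I, mul_one, norm_real,
      Real.norm_of_nonneg hr.le] at this
    exact hn ⟨⟨hr.le, this⟩, Ioo_subset_Icc_self hθ⟩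
  simp [this]

lemma integral_fderiv_radial {h : ℂ → ℂ} (hh : ContDiff ℝ 1 h) (hc : HasCompactSupport h)
    {e : ℂ} (he : ‖e‖ = 1) : ∫ r in Ioi (0 : ℝ), fderiv ℝ h (r * e) e = - h 0 := by
  obtain ⟨R, hR⟩ := hc.isCompact.isBounded.subset_closedBall 0
  have hout : ∀ r : ℝ, 0 ≤ r → R < r → (r * e : ℂ) ∉ tsupport h := by
    intro r hr hRr hm
    have := hR hm
    rw [mem_closedBall_zero_iff, norm_mul, he, mul_one, norm_real, Real.norm_of_nonneg hr] at this
    linarith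
  have hcont : Continuous fun r : ℝ ↦ fderiv ℝ h (r * e) e := by
    have := hh.continuous_fderiv one_ne_zero
    fun_prop
  have key := integral_Ioi_of_hasDerivAt_of_tendsto' (f := fun r : ℝ ↦ h (r * e))
    (f' := fun r : ℝ ↦ fderiv ℝ h (r * e) e) (a := 0) (m := 0) ?_ ?_ ?_
  · simpa using key
  · intro r _
    have h1 : HasDerivAt (fun r : ℝ ↦ (r * e : ℂ)) e r := by
      simpa using (hasDerivAt_id r).ofReal_comp.mul_const e
    exact ((hh.differentiable one_ne_zero) _).hasFDerivAt.comp_hasDerivAt r h1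
  · refine IntegrableOn.of_forall_sdiff_eq_zero (s := Icc (0 : ℝ) R)
      (hcont.continuousOn.integrableOn_compact isCompact_Icc) measurableSet_Ioi ?_
    rintro r ⟨hr, hn⟩
    have hr : 0 < r := hr
    have hRr : R < r := by
      by_contra! hle
      exact hn ⟨hr.le, hle⟩
    rw [image_eq_zero_of_notMem_tsupport
      (fun hm ↦ hout r hr.le hRr (tsupport_fderiv_subset ℝ hm))]
    simp
  · refine tendsto_const_nhds.congr' ?_
    filter_upwards [eventually_gt_atTop R, eventually_ge_atTop 0] with r h1 h2
    exact (image_eq_zero_of_notMem_tsupport (hout r h2 h1)).symm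

lemma integral_fderiv_angular {h : ℂ → ℂ} (hh : ContDiff ℝ 1 h) {r : ℝ} (hr : r ≠ 0) :
    ∫ θ in Ioo (-Real.pi) Real.pi, fderiv ℝ h (r * exp (θ * I)) (I * exp (θ * I)) = 0 := by
  have hcont : Continuous fun θ : ℝ ↦
      r • fderiv ℝ h (r * exp (θ * I)) (I * exp (θ * I)) := by
    have := hh.continuous_fderiv one_ne_zero
    fun_prop
  have key := intervalIntegral.integral_eq_sub_of_hasDerivAt (a := -Real.pi) (b := Real.pi)
    (f := fun θ : ℝ ↦ h (r * exp (θ * I)))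
    (f' := fun θ : ℝ ↦ r • fderiv ℝ h (r * exp (θ * I)) (I * exp (θ * I))) ?_
    (hcont.intervalIntegrable _ _)
  · rw [intervalIntegral.integral_of_le (by linarith [Real.pi_pos]), integral_Ioc_eq_integral_Ioo,
      integral_smul] at key
    have hend : h (r * exp ((Real.pi : ℝ) * I)) = h (r * exp ((-Real.pi : ℝ) * I)) := by
      congr 2
      push_cast
      rw [neg_mul, exp_neg, exp_pi_mul_I]
      norm_num
    rw [hend, sub_self] at key
    exact (smul_eq_zero.1 key).resolve_left hr
  · intro θ _
    have h1 : HasDerivAt (fun θ : ℝ ↦ (r * exp (θ * I) : ℂ)) (r • (I * exp (θ * I))) θ := by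
      have := (((hasDerivAt_id θ).ofReal_comp.mul_const I).cexp).const_mul (r : ℂ)
      refine this.congr_deriv ?_
      simp only [id, real_smul, one_mul, ofReal_one]
      ring
    rw [← map_smul]
    exact ((hh.differentiable one_ne_zero) _).hasFDerivAt.comp_hasDerivAt θ h1

/-- The Cauchy–Pompeiu formula at the origin for compactly supported functions. -/
lemma integral_inv_mul_wirtingerBar {h : ℂ → ℂ} (hh : ContDiff ℝ 1 h)
    (hc : HasCompactSupport h) :
    ∫ w, w⁻¹ * wirtingerBar h w = - (Real.pi * h 0) := by
  set S := Ioi (0 : ℝ) ×ˢ Ioo (-Real.pi) Real.pi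
  let D (c : ℂ) (p : ℝ × ℝ) : ℂ := fderiv ℝ h (p.1 * exp (p.2 * I)) (c * exp (p.2 * I))
  have hD (c : ℂ) : IntegrableOn (D c) S := integrableOn_fderiv_polar hh hc c
  have hmeas : MeasurableSet S := measurableSet_Ioi.prod measurableSet_Ioo
  have hpt : ∀ p ∈ S, p.1 • ((Complex.polarCoord.symm p)⁻¹ *
      wirtingerBar h (Complex.polarCoord.symm p)) = (1 / 2 : ℂ) * (D 1 p + I * D I p) := by
    rintro ⟨r, θ⟩ ⟨hr, -⟩
    have hr : (r : ℂ) ≠ 0 := ofReal_ne_zero.2 (ne_of_gt hr)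
    have hp : Complex.polarCoord.symm (r, θ) = r * exp (θ * I) := by
      rw [Complex.polarCoord_symm_apply, exp_mul_I, ofReal_cos, ofReal_sin]
    have hinv : (exp (θ * I))⁻¹ = Real.cos θ - Real.sin θ * I := by
      rw [← exp_neg, ← neg_mul, exp_mul_I, Complex.cos_neg, Complex.sin_neg]
      push_cast
      ring
    have e1 : exp (θ * I) = Real.cos θ • (1 : ℂ) + Real.sin θ • I := by
      rw [exp_mul_I]; simp
    have e2 : I * exp (θ * I) = Real.cos θ • I - Real.sin θ • (1 : ℂ) := by
      rw [exp_mul_I]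
      simp only [real_smul, ofReal_cos, ofReal_sin]
      linear_combination sin θ * I_mul_I
    simp only [hp, D, wirtingerBar, one_mul]
    generalize fderiv ℝ h (r * exp (θ * I)) = L
    rw [mul_inv, hinv, e2]
    conv_rhs => rw [e1]
    simp only [map_add, map_sub, map_smul]
    simp only [real_smul]
    field_simp
    ring_nf
    simp only [I_sq]
    ring
  rw [← Complex.integral_comp_polarCoord_symm, polarCoord_target, setIntegral_congr_fun hmeas hpt,
    integral_const_mul, integral_add (hD 1) ((hD I).const_mul I), integral_const_mul]
  have i1 : ∫ p in S, D 1 p = - (2 * Real.pi * h 0) := by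
    have : ∫ p in S, D 1 p = ∫ p in Ioo (-Real.pi) Real.pi ×ˢ Ioi (0 : ℝ), D 1 p.swap :=
      (setIntegral_prod_swap (Ioi (0:ℝ)) (Ioo (-Real.pi) Real.pi) (D 1)).symm
    rw [this, Measure.volume_eq_prod, setIntegral_prod]
    · have : ∀ θ : ℝ, ∫ r in Ioi (0 : ℝ), D 1 (θ, r).swap = - h 0 := fun θ ↦ by
        simpa [D] using integral_fderiv_radial hh hc (norm_exp_ofReal_mul_I θ)
      simp only [this]
      rw [setIntegral_const, Real.volume_real_Ioo_of_le (by linarith [Real.pi_pos]), real_smul]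
      push_cast
      ring
    · have := (hD 1).swap
      exact this
  have i2 : ∫ p in S, D I p = 0 := by
    rw [Measure.volume_eq_prod, setIntegral_prod _ (hD I)]
    refine setIntegral_eq_zero_of_forall_eq_zero fun r hr ↦ ?_
    exact integral_fderiv_angular hh (ne_of_gt hr)
  rw [i1, i2]
  ring

lemma wirtingerBar_add {f g : ℂ → ℂ} {z : ℂ} (hf : DifferentiableAt ℝ f z)
    (hg : DifferentiableAt ℝ g z) :
    wirtingerBar (fun w ↦ f w + g w) z = wirtingerBar f z + wirtingerBar g z := by
  simp only [wirtingerBar, fderiv_fun_add hf hg, _root_.add_apply]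
  ring

lemma wirtingerBar_eq_zero {f : ℂ → ℂ} {z : ℂ} (hf : DifferentiableAt ℂ f z) :
    wirtingerBar f z = 0 := by
  rw [wirtingerBar, hf.fderiv_restrictScalars ℝ]
  have := (fderiv ℂ f z).map_smul I 1
  simp only [smul_eq_mul, mul_one] at this
  simp only [ContinuousLinearMap.coe_restrictScalars', this]
  linear_combination (1 / 2 : ℂ) * fderiv ℂ f z 1 * I_mul_I

lemma wirtingerBar_mul_of_differentiableAt {a f : ℂ → ℂ} {z : ℂ} (ha : DifferentiableAt ℂ a z)
    (hf : DifferentiableAt ℝ f z) :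
    wirtingerBar (fun w ↦ a w * f w) z = a z * wirtingerBar f z := by
  have h0 := wirtingerBar_eq_zero ha
  simp only [wirtingerBar] at h0 ⊢
  rw [fderiv_fun_mul (ha.restrictScalars ℝ) hf]
  simp only [_root_.add_apply, _root_.smul_apply, smul_eq_mul]
  linear_combination f z * h0

lemma wirtingerBar_congr {f g : ℂ → ℂ} {z : ℂ} (h : f =ᶠ[𝓝 z] g) :
    wirtingerBar f z = wirtingerBar g z := by
  rw [wirtingerBar, wirtingerBar, h.fderiv_eq]

lemma locallyIntegrable_inv : LocallyIntegrable (fun w : ℂ ↦ w⁻¹) := by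
  refine locallyIntegrable_of_norm_le_rpow (C := 1) (α := 1) ?_ ?_ ?_ ?_
  · simp
  · simp
  · refine .of_forall fun w ↦ ?_
    rw [norm_inv, Real.rpow_neg_one, one_mul]
  · exact measurable_inv.aestronglyMeasurable

/-- The Cauchy transform of `F`, up to the factor `1 / π`. -/
noncomputable def cauchyTransform (F : ℂ → ℂ) (z : ℂ) : ℂ := ∫ w, F w * (z - w)⁻¹

open scoped Convolution in
lemma cauchyTransform_eq_convolution (h : ℂ → ℂ) :
    cauchyTransform h =
      ((fun w : ℂ ↦ w⁻¹) ⋆[ContinuousLinearMap.mul ℝ ℂ, volume] h : ℂ → ℂ) := by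
  ext z
  rw [convolution_def, cauchyTransform, ← integral_sub_left_eq_self _ volume z]
  simp [mul_comm]

lemma integrable_mul_inv_sub {h : ℂ → ℂ} (hh : Continuous h) (hc : HasCompactSupport h) (z : ℂ) :
    Integrable fun w ↦ h w * (z - w)⁻¹ := by
  have := hc.convolutionExists_right (ContinuousLinearMap.mul ℝ ℂ) locallyIntegrable_inv hh z
  have h2 := Integrable.comp_sub_left this z
  simpa [mul_comm] using h2

lemma contDiff_cauchyTransform {h : ℂ → ℂ} (hh : ContDiff ℝ (⊤ : ℕ∞) h)
    (hc : HasCompactSupport h) : ContDiff ℝ (⊤ : ℕ∞) (cauchyTransform h) := by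
  rw [cauchyTransform_eq_convolution]
  exact hc.contDiff_convolution_right _ locallyIntegrable_inv hh

lemma wirtingerBar_cauchyTransform_of_contDiff {h : ℂ → ℂ} (hh : ContDiff ℝ 1 h)
    (hc : HasCompactSupport h) (z : ℂ) :
    wirtingerBar (cauchyTransform h) z = Real.pi * h z := by
  have hd := hh.continuous_fderiv one_ne_zero
  have hD (v : ℂ) : fderiv ℝ (cauchyTransform h) z v = ∫ w, w⁻¹ * fderiv ℝ h (z - w) v := by
    rw [cauchyTransform_eq_convolution,
      (hc.hasFDerivAt_convolution_right _ locallyIntegrable_inv hh z).fderiv,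
      convolution_precompR_apply _ locallyIntegrable_inv (hc.fderiv (𝕜 := ℝ)) hd]
    rfl
  have hint (v : ℂ) : Integrable fun w ↦ w⁻¹ * fderiv ℝ h (z - w) v := by
    have := (hc.fderiv_apply (𝕜 := ℝ) v).convolutionExists_right (ContinuousLinearMap.mul ℝ ℂ)
      locallyIntegrable_inv (by fun_prop) z
    exact this
  have hk : ContDiff ℝ 1 fun w ↦ h (z - w) := by fun_prop
  have hkc : HasCompactSupport fun w ↦ h (z - w) :=
    hc.comp_homeomorph (Homeomorph.subLeft z)
  have hbar (w : ℂ) : wirtingerBar (fun w ↦ h (z - w)) w = - wirtingerBar h (z - w) := by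
    have : fderiv ℝ (fun w ↦ h (z - w)) w = - fderiv ℝ h (z - w) := by
      have h1 := (hh.differentiable one_ne_zero (z - w)).hasFDerivAt.comp w
        ((hasFDerivAt_id w).const_sub z)
      refine h1.fderiv.trans ?_
      ext v
      simp
    simp only [wirtingerBar, this, _root_.neg_apply]
    ring
  have key := integral_inv_mul_wirtingerBar hk hkc
  simp only [hbar, mul_neg, integral_neg, sub_zero, neg_inj] at key
  rw [← key, wirtingerBar, hD, hD, ← integral_const_mul, ← integral_add (hint _)
    ((hint _).const_mul _), ← integral_const_mul]
  congr with w
  simp only [wirtingerBar]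
  ring

section Far

variable {F : ℂ → ℂ} {z₀ : ℂ} {δ : ℝ}

lemma integrable_mul_inv_sub_of_eq_zero (hF : Integrable F)
    (hδ : 0 < δ) (h0 : ∀ w ∈ ball z₀ δ, F w = 0) {z : ℂ} (hz : z ∈ ball z₀ (δ / 2)) :
    Integrable fun w ↦ F w * (z - w)⁻¹ := by
  refine (hF.norm.mul_const (δ / 2)⁻¹).mono'
    (hF.aestronglyMeasurable.mul (by fun_prop)) (.of_forall fun w ↦ ?_)
  by_cases hw : w ∈ ball z₀ δ
  · simp [h0 w hw]
  · rw [norm_mul, norm_inv, ← dist_eq_norm]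
    have : δ / 2 ≤ dist z w := by
      rw [mem_ball] at hz hw
      have := dist_triangle w z z₀
      rw [dist_comm w z] at this
      linarith
    gcongr

lemma differentiableAt_cauchyTransform_of_eq_zero (hF : Integrable F)
    (hδ : 0 < δ) (h0 : ∀ w ∈ ball z₀ δ, F w = 0) {z : ℂ} (hz : z ∈ ball z₀ (δ / 2)) :
    DifferentiableAt ℂ (cauchyTransform F) z := by
  have hfar : ∀ w ∉ ball z₀ δ, ∀ x ∈ ball z₀ (δ / 2), δ / 2 ≤ ‖x - w‖ := by
    intro w hw x hx
    rw [mem_ball] at hx hw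
    have := dist_triangle w x z₀
    rw [dist_comm w x, dist_eq_norm x w] at this
    linarith
  have key := hasDerivAt_integral_of_dominated_loc_of_deriv_le (μ := volume)
    (F := fun z w ↦ F w * (z - w)⁻¹) (F' := fun z w ↦ F w * (-1 / (z - w) ^ 2))
    (bound := fun w ↦ ‖F w‖ * ((δ / 2) ^ 2)⁻¹) (x₀ := z) (isOpen_ball.mem_nhds hz)
    (.of_forall fun x ↦ hF.aestronglyMeasurable.mul (by fun_prop))
    (integrable_mul_inv_sub_of_eq_zero hF hδ h0 hz)
    (hF.aestronglyMeasurable.mul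
      (by fun_prop : Measurable fun w ↦ -1 / (z - w) ^ 2).aestronglyMeasurable)
    (.of_forall fun w x hx ↦ ?_) (hF.norm.mul_const _) (.of_forall fun w x hx ↦ ?_)
  · exact key.2.differentiableAt
  · by_cases hw : w ∈ ball z₀ δ
    · simp [h0 w hw]
    · have := hfar w hw x hx
      rw [norm_mul, norm_div, norm_neg, norm_one, one_div, norm_pow]
      gcongr
  · by_cases hw : w ∈ ball z₀ δ
    · simpa [h0 w hw] using hasDerivAt_const x (0 : ℂ)
    · have hne : x - w ≠ 0 := norm_pos_iff.1 ((half_pos hδ).trans_le (hfar w hw x hx))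
      exact (((hasDerivAt_id x).sub_const w).inv hne).const_mul _

end Far

lemma contDiffOn_bump_mul {z₀ : ℂ} (b : ContDiffBump z₀) {F : ℂ → ℂ} {s t : Set ℂ}
    (hs : IsOpen s) (hbs : t ∩ closedBall z₀ b.rOut ⊆ s) (hF : ContDiffOn ℝ (⊤ : ℕ∞) F s) :
    ContDiffOn ℝ (⊤ : ℕ∞) (fun w ↦ (b w : ℂ) * F w) t := by
  intro x hxt
  refine ContDiffAt.contDiffWithinAt ?_
  by_cases hx : x ∈ s
  · exact (ofRealCLM.contDiff.contDiffAt.comp x b.contDiffAt).mul (hF.contDiffAt (hs.mem_nhds hx))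
  · have : x ∉ tsupport b := fun h ↦ hx (hbs ⟨hxt, b.tsupport_eq ▸ h⟩)
    refine (contDiffAt_const (c := (0 : ℂ))).congr_of_eventuallyEq ?_
    filter_upwards [notMem_tsupport_iff_eventuallyEq.1 this] with w hw
    simp [hw]

/-- The Cauchy transform of an integrable function solves the `∂̄`-equation near every point
around which the function is smooth. -/
lemma cauchyTransform_of_contDiffOn_ball {F : ℂ → ℂ} (hF : Integrable F) {z₀ : ℂ} {δ : ℝ}
    (hδ : 0 < δ) (hs : ContDiffOn ℝ (⊤ : ℕ∞) F (ball z₀ δ)) :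
    ContDiffAt ℝ (⊤ : ℕ∞) (cauchyTransform F) z₀ ∧
      wirtingerBar (cauchyTransform F) z₀ = Real.pi * F z₀ := by
  let b : ContDiffBump z₀ := ⟨δ / 3, δ / 2, by positivity, by linarith⟩
  set h : ℂ → ℂ := fun w ↦ (b w : ℂ) * F w with hdef
  have hh : ContDiff ℝ (⊤ : ℕ∞) h :=
    contDiffOn_univ.1 <| contDiffOn_bump_mul b isOpen_ball
      (inter_subset_right.trans (closedBall_subset_ball (half_lt_self hδ))) hs
  have hc : HasCompactSupport h := by
    have : HasCompactSupport fun w ↦ (b w : ℂ) := b.hasCompactSupport.comp_left ofReal_zero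
    exact this.mul_right
  set G : ℂ → ℂ := fun w ↦ F w - h w with hGdef
  have hG : Integrable G := hF.sub (hh.continuous.integrable_of_hasCompactSupport hc)
  have hδ3 : 0 < δ / 3 := by positivity
  have hb1 : ∀ w ∈ ball z₀ (δ / 3), h w = F w := fun w hw ↦ by
    simp [hdef, b.one_of_mem_closedBall (ball_subset_closedBall hw)]
  have hG0 : ∀ w ∈ ball z₀ (δ / 3), G w = 0 := fun w hw ↦ by simp [hGdef, hb1 w hw]
  have hnhds : ball z₀ (δ / 3 / 2) ∈ 𝓝 z₀ := ball_mem_nhds _ (by positivity)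
  have hsplit : cauchyTransform F =ᶠ[𝓝 z₀] fun z ↦ cauchyTransform h z + cauchyTransform G z := by
    filter_upwards [hnhds] with z hz
    rw [cauchyTransform, cauchyTransform, cauchyTransform,
      ← integral_add (integrable_mul_inv_sub hh.continuous hc z)
        (integrable_mul_inv_sub_of_eq_zero hG hδ3 hG0 hz)]
    congr with w
    simp only [hGdef]
    ring
  have hdiff : DifferentiableOn ℂ (cauchyTransform G) (ball z₀ (δ / 3 / 2)) := fun z hz ↦
    (differentiableAt_cauchyTransform_of_eq_zero hG hδ3 hG0 hz).differentiableWithinAt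
  have hGc : ContDiffAt ℝ (⊤ : ℕ∞) (cauchyTransform G) z₀ :=
    ((hdiff.contDiffOn isOpen_ball).contDiffAt hnhds).restrict_scalars ℝ
  have hhc := contDiff_cauchyTransform hh hc
  refine ⟨(hhc.contDiffAt.add hGc).congr_of_eventuallyEq hsplit, ?_⟩
  rw [wirtingerBar_congr hsplit, wirtingerBar_add (hhc.contDiffAt.differentiableAt (by simp))
      (hGc.differentiableAt (by simp)),
    wirtingerBar_cauchyTransform_of_contDiff (hh.of_le (by exact_mod_cast le_top)) hc,
    wirtingerBar_eq_zero (hdiff.differentiableAt hnhds), add_zero,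
    hb1 z₀ (mem_ball_self hδ3)]

section Kernel

variable {ε : ℝ}

/-- A radial majorant of `|u|^(ε-2) / |e - u|`, for a unit vector `e`, away from `e`. -/
noncomputable def originKernel (ε : ℝ) (r : ℝ) : ℝ :=
  if r < 1 / 2 then 2 * r ^ (ε - 2) else 3 * r ^ (ε - 3)

/-- A majorant of `|u|^(ε-2) / |e - u|` near the unit vector `e`, radial around `e`. -/
noncomputable def poleKernel (ε : ℝ) (r : ℝ) : ℝ :=
  if r < 1 / 2 then (1 / 2) ^ (ε - 2) * r⁻¹ else 0

lemma integrable_originKernel (hε : ε ∈ Ioo (0 : ℝ) 1) :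
    Integrable fun u : ℂ ↦ originKernel ε ‖u‖ := by
  rw [integrable_fun_norm_addHaar, finrank_real_complex,
    ← Ioo_union_Ici_eq_Ioi (show (0 : ℝ) < 1 / 2 by norm_num)]
  refine IntegrableOn.union ?_ ?_
  · have : IntegrableOn (fun y : ℝ ↦ 2 * y ^ (ε - 1)) (Ioo 0 (1 / 2)) :=
      ((intervalIntegral.integrableOn_Ioo_rpow_iff (by norm_num)).2 (by linarith [hε.1])).const_mul 2
    refine this.congr_fun (fun y hy ↦ ?_) measurableSet_Ioo
    have h2 : ε - 1 = 1 + (ε - 2) := by ring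
    simp only [originKernel, if_pos hy.2, smul_eq_mul, h2, Real.rpow_add hy.1, Real.rpow_one]
    ring
  · rw [integrableOn_Ici_iff_integrableOn_Ioi]
    have : IntegrableOn (fun y : ℝ ↦ 3 * y ^ (ε - 2)) (Ioi (1 / 2)) :=
      (integrableOn_Ioi_rpow_of_lt (by linarith [hε.2]) (by norm_num)).const_mul 3
    refine this.congr_fun (fun y (hy : 1 / 2 < y) ↦ ?_) measurableSet_Ioi
    have hy0 : 0 < y := by linarith
    have h2 : ε - 2 = 1 + (ε - 3) := by ring
    simp only [originKernel, if_neg hy.not_gt, smul_eq_mul, h2, Real.rpow_add hy0, Real.rpow_one]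
    ring

lemma integrable_poleKernel : Integrable fun u : ℂ ↦ poleKernel ε ‖u‖ := by
  rw [integrable_fun_norm_addHaar, finrank_real_complex]
  have : IntegrableOn (fun _ : ℝ ↦ (1 / 2 : ℝ) ^ (ε - 2)) (Ioo 0 (1 / 2)) :=
    integrableOn_const (by simp)
  refine (this.congr_fun (fun y hy ↦ ?_) measurableSet_Ioo).of_forall_sdiff_eq_zero
    measurableSet_Ioi fun y hy ↦ ?_
  · have := hy.1.ne'
    simp only [poleKernel, if_pos hy.2, smul_eq_mul, Nat.add_one_sub_one, pow_one]
    field_simp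
  · have : ¬ y < 1 / 2 := fun h ↦ hy.2 ⟨hy.1, h⟩
    simp only [poleKernel, if_neg this, smul_zero]

lemma norm_rpow_mul_inv_le (hε : ε ∈ Ioo (0 : ℝ) 1) {e : ℂ} (he : ‖e‖ = 1) (u : ℂ) :
    ‖u‖ ^ (ε - 2) * ‖e - u‖⁻¹ ≤ originKernel ε ‖u‖ + poleKernel ε ‖u - e‖ := by
  have t1 : 1 ≤ ‖e - u‖ + ‖u‖ := by
    simpa [he] using norm_add_le (e - u) u
  have t2 : ‖u‖ ≤ ‖e - u‖ + 1 := by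
    simpa [he, norm_sub_rev] using norm_add_le (u - e) e
  rw [norm_sub_rev u e]
  by_cases h1 : ‖u‖ < 1 / 2
  · have h2 : ¬ ‖e - u‖ < 1 / 2 := by linarith
    rw [originKernel, poleKernel, if_pos h1, if_neg h2, add_zero, mul_comm]
    have : ‖e - u‖⁻¹ ≤ 2 := inv_le_of_inv_le₀ (by norm_num) (by linarith)
    gcongr
  have hu : 0 < ‖u‖ := by linarith
  by_cases h2 : ‖e - u‖ < 1 / 2
  · rw [originKernel, poleKernel, if_neg h1, if_pos h2]
    have : ‖u‖ ^ (ε - 2) ≤ (1 / 2) ^ (ε - 2) :=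
      Real.rpow_le_rpow_of_nonpos (by norm_num) (not_lt.1 h1) (by linarith [hε.2])
    have h3 : 0 ≤ 3 * ‖u‖ ^ (ε - 3) := by positivity
    have : ‖u‖ ^ (ε - 2) * ‖e - u‖⁻¹ ≤ (1 / 2) ^ (ε - 2) * ‖e - u‖⁻¹ := by gcongr
    linarith
  · rw [originKernel, poleKernel, if_neg h1, if_neg h2, add_zero]
    have h3 : ε - 3 = ε - 2 + -1 := by ring
    have : ‖e - u‖⁻¹ ≤ 3 * ‖u‖⁻¹ := by
      rw [← div_eq_mul_inv, inv_le_comm₀ (by linarith) (by positivity), inv_div,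
        div_le_iff₀ (by norm_num)]
      linarith
    rw [h3, Real.rpow_add hu, Real.rpow_neg_one, mul_left_comm]
    gcongr

/-- The kernel `|w|^(ε-2) / |z - w|` is integrable with integral `O(|z|^(ε-1))`. -/
lemma exists_integral_norm_rpow_mul_inv_le (hε : ε ∈ Ioo (0 : ℝ) 1) :
    ∃ K : ℝ, 0 ≤ K ∧ ∀ z : ℂ, z ≠ 0 →
      Integrable (fun w : ℂ ↦ ‖w‖ ^ (ε - 2) * ‖z - w‖⁻¹) ∧
      ∫ w : ℂ, ‖w‖ ^ (ε - 2) * ‖z - w‖⁻¹ ≤ K * ‖z‖ ^ (ε - 1) := by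
  let K : ℝ := (∫ u : ℂ, originKernel ε ‖u‖) + ∫ u : ℂ, poleKernel ε ‖u‖
  have hunit : ∀ e : ℂ, ‖e‖ = 1 → Integrable (fun u : ℂ ↦ ‖u‖ ^ (ε - 2) * ‖e - u‖⁻¹) ∧
      ∫ u : ℂ, ‖u‖ ^ (ε - 2) * ‖e - u‖⁻¹ ≤ K := by
    intro e he
    have hpol : Integrable fun u : ℂ ↦ poleKernel ε ‖u - e‖ :=
      integrable_poleKernel.comp_sub_right e
    have hsum := (integrable_originKernel hε).add hpol
    have hle := norm_rpow_mul_inv_le hε he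
    have hint : Integrable (fun u : ℂ ↦ ‖u‖ ^ (ε - 2) * ‖e - u‖⁻¹) := by
      refine hsum.mono' (by fun_prop : Measurable _).aestronglyMeasurable (.of_forall fun u ↦ ?_)
      rw [Real.norm_of_nonneg (by positivity)]
      exact hle u
    refine ⟨hint, (integral_mono hint hsum hle).trans_eq ?_⟩
    simp only [Pi.add_apply]
    rw [integral_add (integrable_originKernel hε) hpol,
      integral_sub_right_eq_self (fun u ↦ poleKernel ε ‖u‖) e]
  refine ⟨K, le_trans (integral_nonneg fun u ↦ by positivity) (hunit 1 norm_one).2,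
    fun z hz ↦ ?_⟩
  have hr : 0 < ‖z‖ := norm_pos_iff.2 hz
  set r := ‖z‖
  obtain ⟨h1, h2⟩ := hunit (r⁻¹ • z) (by
    rw [norm_smul, norm_inv, norm_norm, inv_mul_cancel₀ hr.ne'])
  have hscale : (fun w : ℂ ↦ ‖w‖ ^ (ε - 2) * ‖z - w‖⁻¹) = fun w ↦
      r ^ (ε - 3) * (‖r⁻¹ • w‖ ^ (ε - 2) * ‖r⁻¹ • z - r⁻¹ • w‖⁻¹) := by
    ext w
    have h3 : ε - 3 = ε - 2 + -1 := by ring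
    rw [← smul_sub, norm_smul, norm_smul, norm_inv, Real.norm_of_nonneg hr.le,
      Real.mul_rpow (by positivity) (by positivity), Real.inv_rpow hr.le, h3, Real.rpow_add hr,
      Real.rpow_neg_one]
    have := Real.rpow_pos_of_pos hr (ε - 2)
    field_simp
  rw [hscale]
  refine ⟨(h1.comp_smul (inv_ne_zero hr.ne')).const_mul _, ?_⟩
  have h4 : r ^ (ε - 1) = r ^ (ε - 3) * r ^ 2 := by
    rw [← Real.rpow_natCast r 2, ← Real.rpow_add hr]
    congr 1
    push_cast
    ring
  rw [integral_const_mul, Measure.integral_comp_inv_smul_of_nonneg _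
    (fun u : ℂ ↦ ‖u‖ ^ (ε - 2) * ‖r⁻¹ • z - u‖⁻¹) hr.le, finrank_real_complex, smul_eq_mul, h4,
    mul_comm K, ← mul_assoc]
  gcongr

end Kernel

lemma integrable_of_norm_le_rpow_of_support_subset {F : ℂ → ℂ} {C a R : ℝ} (ha : -2 < a)
    (hF : AEStronglyMeasurable F) (hb : ∀ w ≠ 0, ‖F w‖ ≤ C * ‖w‖ ^ a)
    (hsupp : Function.support F ⊆ ball 0 R) : Integrable F := by
  rw [← integrableOn_iff_integrable_of_support_subset hsupp]
  refine integrableOn_ball_of_norm_le_rpow (C := C) (α := -a) (by simp) ?_ ?_ hF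
  · simp
    linarith
  · refine ae_restrict_of_ae ?_
    filter_upwards [Measure.ae_ne volume (0 : ℂ)] with w hw
    simpa using hb w hw

/-- For `F` supported in a ball and smooth away from `0` with `F = O(|z|^(ε-1))`, the equation
`∂G/∂z̄ = F` has a solution away from `0` with `G = O(|z|^ε)`. -/
lemma exists_wirtingerBar_eq_of_norm_le_rpow {ε : ℝ} (hε : ε ∈ Ioo (0 : ℝ) 1) {F : ℂ → ℂ}
    (hF : ContDiffOn ℝ (⊤ : ℕ∞) F {0}ᶜ) {C R : ℝ} (hC : 0 ≤ C)
    (hb : ∀ w ≠ 0, ‖F w‖ ≤ C * ‖w‖ ^ (ε - 1)) (hsupp : Function.support F ⊆ ball 0 R) :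
    ∃ G : ℂ → ℂ, ContDiffOn ℝ (⊤ : ℕ∞) G {0}ᶜ ∧ (∀ z ≠ 0, wirtingerBar G z = F z) ∧
      ∃ C' : ℝ, 0 ≤ C' ∧ ∀ z ≠ 0, ‖G z‖ ≤ C' * ‖z‖ ^ ε := by
  have hmeas : AEStronglyMeasurable F := by
    have := hF.continuousOn.aestronglyMeasurable (μ := volume) (measurableSet_singleton 0).compl
    rwa [restrict_compl_singleton] at this
  have hFint : Integrable F :=
    integrable_of_norm_le_rpow_of_support_subset (by linarith [hε.1]) hmeas hb hsupp
  have h0int : Integrable fun w ↦ F w * (0 - w)⁻¹ := by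
    refine integrable_of_norm_le_rpow_of_support_subset (C := C) (a := ε - 2) (R := R)
      (by linarith [hε.1]) (hmeas.mul (by fun_prop)) (fun w hw ↦ ?_)
      ((Function.support_mul_subset_left _ _).trans hsupp)
    have hw' := norm_pos_iff.2 hw
    have h3 : ε - 2 = ε - 1 + -1 := by ring
    rw [norm_mul, norm_inv, zero_sub, norm_neg, h3, Real.rpow_add hw', Real.rpow_neg_one,
      ← mul_assoc]
    gcongr
    exact hb w hw
  have hloc : ∀ z : ℂ, z ≠ 0 → ContDiffAt ℝ (⊤ : ℕ∞) (cauchyTransform F) z ∧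
      wirtingerBar (cauchyTransform F) z = Real.pi * F z := by
    intro z hz
    refine cauchyTransform_of_contDiffOn_ball hFint (norm_pos_iff.2 hz) (hF.mono fun w hw h ↦ ?_)
    rw [mem_singleton_iff.1 h, mem_ball, dist_zero_left] at hw
    exact lt_irrefl _ hw
  obtain ⟨K, hK, hKz⟩ := exists_integral_norm_rpow_mul_inv_le hε
  have hpi : (Real.pi : ℂ) ≠ 0 := ofReal_ne_zero.2 Real.pi_ne_zero
  refine ⟨fun z ↦ (Real.pi : ℂ)⁻¹ * (cauchyTransform F z + -cauchyTransform F 0), ?_, ?_,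
    Real.pi⁻¹ * (C * K), by positivity, ?_⟩
  · exact fun z hz ↦ (contDiffAt_const.mul
      ((hloc z hz).1.add contDiffAt_const)).contDiffWithinAt
  · intro z hz
    have hd : DifferentiableAt ℝ (cauchyTransform F) z := (hloc z hz).1.differentiableAt (by simp)
    rw [wirtingerBar_mul_of_differentiableAt (differentiableAt_const _)
        (hd.fun_add (differentiableAt_const _)),
      wirtingerBar_add hd (differentiableAt_const _),
      wirtingerBar_eq_zero (differentiableAt_const _), (hloc z hz).2, add_zero,
      inv_mul_cancel_left₀ hpi]
  · intro z hz
    have hz' := norm_pos_iff.2 hz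
    obtain ⟨hk1, hk2⟩ := hKz z hz
    have hdom : ∀ᵐ w, ‖F w * (z - w)⁻¹ - F w * (0 - w)⁻¹‖ ≤
        C * ‖z‖ * (‖w‖ ^ (ε - 2) * ‖z - w‖⁻¹) := by
      filter_upwards [Measure.ae_ne volume (0 : ℂ), Measure.ae_ne volume z] with w hw hwz
      have hw' := norm_pos_iff.2 hw
      have hzw : z - w ≠ 0 := sub_ne_zero.2 hwz.symm
      have h3 : ε - 2 = ε - 1 + -1 := by ring
      have : F w * (z - w)⁻¹ - F w * (0 - w)⁻¹ = F w * (z * w⁻¹ * (z - w)⁻¹) := by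
        rw [zero_sub]
        field_simp
        ring
      rw [this, norm_mul, norm_mul, norm_mul, norm_inv, norm_inv, h3, Real.rpow_add hw',
        Real.rpow_neg_one]
      calc _ ≤ C * ‖w‖ ^ (ε - 1) * (‖z‖ * ‖w‖⁻¹ * ‖z - w‖⁻¹) := by
            gcongr
            exact hb w hw
        _ = _ := by ring
    have hdint : Integrable fun w ↦ F w * (z - w)⁻¹ - F w * (0 - w)⁻¹ :=
      (hk1.const_mul _).mono' ((hmeas.mul (by fun_prop)).sub (hmeas.mul (by fun_prop))) hdom
    have hzint : Integrable fun w ↦ F w * (z - w)⁻¹ := by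
      refine (hdint.add h0int).congr (.of_forall fun w ↦ ?_)
      simp only [Pi.add_apply, sub_add_cancel]
    rw [norm_mul, norm_inv, norm_real, Real.norm_of_nonneg Real.pi_pos.le, ← sub_eq_add_neg,
      cauchyTransform, cauchyTransform, ← integral_sub hzint h0int, mul_assoc]
    gcongr
    calc _ ≤ ∫ w, C * ‖z‖ * (‖w‖ ^ (ε - 2) * ‖z - w‖⁻¹) :=
          norm_integral_le_of_norm_le (hk1.const_mul _) hdom
      _ ≤ C * ‖z‖ * (K * ‖z‖ ^ (ε - 1)) := by
          rw [integral_const_mul]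
          gcongr
      _ = C * K * ‖z‖ ^ ε := by
          have h3 : ε = 1 + (ε - 1) := by ring
          conv_rhs => rw [h3, Real.rpow_add hz', Real.rpow_one]
          ring

/-- ∂̄-Poincaré lemma with growth control (Lemma 3.3 of the paper):
given a smooth `f` on a punctured neighborhood of the closed unit disc with
`|f(z)| ≤ C|z|^{ε-k}`, there is a smooth solution `g` of `∂g/∂z̄ = f` on a possibly
smaller punctured neighborhood of the closed disc with `|g(z)| ≤ C'|z|^{ε-k+1}`. -/
theorem dbar_poincare_with_growth
    (k : ℕ) (hk : 0 < k) (ε : ℝ) (hε : ε ∈ Set.Ioo (0 : ℝ) 1)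
    (W₁ : Set ℂ) (hW₁ : IsOpen W₁) (hΔW₁ : Metric.closedBall (0 : ℂ) 1 ⊆ W₁)
    (f : ℂ → ℂ) (hf : ContDiffOn ℝ (⊤ : ℕ∞) f (W₁ \ {0}))
    (C : ℝ) (hC : 0 ≤ C)
    (hbound : ∀ z ∈ W₁ \ {0}, ‖f z‖ ≤ C * ‖z‖ ^ (ε - (k : ℝ))) :
    ∃ W₂ : Set ℂ, IsOpen W₂ ∧ Metric.closedBall (0 : ℂ) 1 ⊆ W₂ ∧ W₂ ⊆ W₁ ∧
      ∃ g : ℂ → ℂ, ContDiffOn ℝ (⊤ : ℕ∞) g (W₂ \ {0}) ∧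
        (∀ z ∈ W₂ \ {0}, wirtingerBar g z = f z) ∧
        ∃ C' : ℝ, 0 ≤ C' ∧
          ∀ z ∈ W₂ \ {0}, ‖g z‖ ≤ C' * ‖z‖ ^ (ε - (k : ℝ) + 1) := by
  obtain ⟨m, rfl⟩ : ∃ m, k = m + 1 := ⟨k - 1, by omega⟩
  obtain ⟨δ, hδ, hδW⟩ := (isCompact_closedBall (0 : ℂ) 1).exists_thickening_subset_open hW₁ hΔW₁
  rw [thickening_closedBall hδ zero_le_one] at hδW
  let b : ContDiffBump (0 : ℂ) := ⟨1 + δ / 3, 1 + δ / 2, by positivity, by linarith⟩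
  have hbW : closedBall (0 : ℂ) b.rOut ⊆ W₁ :=
    (closedBall_subset_ball (show 1 + δ / 2 < δ + 1 by linarith)).trans hδW
  have hbsupp (F : ℂ → ℂ) : Function.support (fun w ↦ (b w : ℂ) * F w) ⊆ ball 0 b.rOut :=
    fun w hw ↦ b.support_eq ▸ fun h ↦ hw (by simp [h])
  have hFb : ∀ w ≠ 0, ‖(b w : ℂ) * (w ^ m * f w)‖ ≤ C * ‖w‖ ^ (ε - 1) := by
    intro w hw
    have hw0 := norm_pos_iff.2 hw
    by_cases hwb : w ∈ ball 0 b.rOut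
    · have h3 : ε - 1 = m + (ε - ((m + 1 : ℕ) : ℝ)) := by push_cast; ring
      rw [norm_mul, norm_mul, norm_pow, norm_real, Real.norm_of_nonneg b.nonneg, h3,
        Real.rpow_add hw0, Real.rpow_natCast, mul_left_comm C]
      have := hbound w ⟨hbW (ball_subset_closedBall hwb), hw⟩
      refine (mul_le_of_le_one_left (by positivity) b.le_one).trans ?_
      gcongr
    · have : b w = 0 := Function.notMem_support.1 (b.support_eq ▸ hwb)
      simp only [this, ofReal_zero, zero_mul, norm_zero]
      positivity
  obtain ⟨G, hGs, hGF, C', hC', hGb⟩ := exists_wirtingerBar_eq_of_norm_le_rpow hε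
    (F := fun w ↦ (b w : ℂ) * (w ^ m * f w)) (C := C) (R := b.rOut)
    (contDiffOn_bump_mul b (hW₁.sdiff isClosed_singleton)
      (fun w hw ↦ ⟨hbW hw.2, hw.1⟩) (by fun_prop)) hC hFb (hbsupp _)
  have hsub : ball (0 : ℂ) (1 + δ / 3) ⊆ W₁ :=
    (ball_subset_ball (by linarith)).trans hδW
  refine ⟨ball 0 (1 + δ / 3), isOpen_ball, closedBall_subset_ball (by linarith), hsub,
    fun z ↦ (z ^ m)⁻¹ * G z, ?_, ?_, C', hC', ?_⟩
  · refine ContDiffOn.mul (ContDiffOn.inv (by fun_prop) fun z hz ↦ pow_ne_zero m hz.2)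
      (hGs.mono fun z hz ↦ hz.2)
  · intro z hz
    have hz0 : z ≠ 0 := hz.2
    rw [wirtingerBar_mul_of_differentiableAt
        (a := fun z ↦ (z ^ m)⁻¹) ((differentiableAt_pow m).fun_inv (pow_ne_zero m hz0))
        ((hGs.contDiffAt (isOpen_compl_singleton.mem_nhds hz0)).differentiableAt (by simp)),
      hGF z hz0, b.one_of_mem_closedBall (ball_subset_closedBall hz.1)]
    simp [hz0]
  · intro z hz
    have hz0 := norm_pos_iff.2 hz.2
    have h3 : ε - ((m + 1 : ℕ) : ℝ) + 1 = -(m : ℝ) + ε := by push_cast; ring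
    rw [norm_mul, norm_inv, norm_pow, h3, Real.rpow_add hz0, Real.rpow_neg hz0.le,
      Real.rpow_natCast, mul_left_comm]
    gcongr
    exact hGb z hz.2
end

section
/- Let a, b ∈ ℝ with a + b + 1 ≠ 0, let M ≥ 0, and let h : (0,1] → ℂ be a continuous function with |h(ρ)| ≤ M·ρ^{b} for all ρ ∈ (0,1]. Define g : (0,1] → ℂ by g(r) = −r^{−a} ∫_r^1 2ρ^{a} h(ρ) dρ. Then g is continuously differentiable on (0,1) and satisfies the ordinary differential equation g′(r) + (a/r)·g(r) = 2·h(r) for all r ∈ (0,1); moreover |g(r)| ≤ (2M/|a+b+1|)·(r^{b+1} + r^{−a}) for all r ∈ (0,1]. -/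
theorem continuousOn_two_mul_rpow_mul (a : ℝ) {h : ℝ → ℂ}
    (hcont : ContinuousOn h (Set.Ioc 0 1)) :
    ContinuousOn (fun ρ : ℝ => ((2 * ρ ^ a : ℝ) : ℂ) * h ρ) (Set.Ioc 0 1) := by
  refine ContinuousOn.mul (Complex.continuous_ofReal.comp_continuousOn ?_) hcont
  exact continuousOn_const.mul
    (continuousOn_id.rpow_const fun x hx => Or.inl hx.1.ne')

theorem hasDerivAt_integral_left_of_continuousOn_Ioc {f : ℝ → ℂ}
    (hf : ContinuousOn f (Set.Ioc 0 1)) {r : ℝ} (hr : r ∈ Set.Ioo (0 : ℝ) 1) :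
    HasDerivAt (fun u => ∫ ρ in u..1, f ρ) (-f r) r := by
  have hIoo : ContinuousOn f (Set.Ioo 0 1) := hf.mono Set.Ioo_subset_Ioc_self
  refine intervalIntegral.integral_hasDerivAt_left ?_
    (hIoo.stronglyMeasurableAtFilter isOpen_Ioo r hr)
    (hIoo.continuousAt (isOpen_Ioo.mem_nhds hr))
  refine (hf.mono ?_).intervalIntegrable
  rw [Set.uIcc_of_le hr.2.le]
  exact fun x hx => ⟨hr.1.trans_le hx.1, hx.2⟩

theorem hasDerivAt_neg_rpow_mul_integral (a : ℝ) {h : ℝ → ℂ}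
    (hcont : ContinuousOn h (Set.Ioc 0 1)) {r : ℝ} (hr : r ∈ Set.Ioo (0 : ℝ) 1) :
    HasDerivAt
      (fun s : ℝ => -((s ^ (-a) : ℝ) : ℂ) * ∫ ρ in s..1, ((2 * ρ ^ a : ℝ) : ℂ) * h ρ)
      (2 * h r - ((a / r : ℝ) : ℂ) *
        (-((r ^ (-a) : ℝ) : ℂ) * ∫ ρ in r..1, ((2 * ρ ^ a : ℝ) : ℂ) * h ρ)) r := by
  have hpow : HasDerivAt (fun s : ℝ => -((s ^ (-a) : ℝ) : ℂ))
      (-((-a * r ^ (-a - 1) : ℝ) : ℂ)) r :=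
    (Real.hasDerivAt_rpow_const (Or.inl hr.1.ne')).ofReal_comp.neg
  have hint := hasDerivAt_integral_left_of_continuousOn_Ioc
    (continuousOn_two_mul_rpow_mul a hcont) hr
  refine (hpow.mul hint).congr_deriv ?_
  have hcancel : ((r ^ (-a) : ℝ) : ℂ) * ((r ^ a : ℝ) : ℂ) = 1 := by
    rw [← Complex.ofReal_mul, ← Real.rpow_add hr.1, neg_add_cancel, Real.rpow_zero,
      Complex.ofReal_one]
  rw [Real.rpow_sub_one hr.1.ne']
  push_cast
  linear_combination (2 * h r) * hcancel

theorem norm_integral_two_mul_rpow_mul_le {a b M : ℝ} (hab : a + b + 1 ≠ 0) (hM : 0 ≤ M)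
    {h : ℝ → ℂ} (hbound : ∀ ρ ∈ Set.Ioc (0 : ℝ) 1, ‖h ρ‖ ≤ M * ρ ^ b)
    {r : ℝ} (hr : r ∈ Set.Ioc (0 : ℝ) 1) :
    ‖∫ ρ in r..1, ((2 * ρ ^ a : ℝ) : ℂ) * h ρ‖ ≤
      2 * M / |a + b + 1| * (r ^ (a + b + 1) + 1) := by
  have h0 : (0 : ℝ) ∉ Set.uIcc r 1 := by
    rw [Set.uIcc_of_le hr.2]
    exact fun hx => hr.1.not_ge hx.1
  have hle : ∀ ρ ∈ Set.Ioc r 1,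
      ‖((2 * ρ ^ a : ℝ) : ℂ) * h ρ‖ ≤ 2 * M * ρ ^ (a + b) := by
    intro ρ hρ
    have hρ0 : 0 < ρ := hr.1.trans hρ.1
    have hpos : 0 ≤ 2 * ρ ^ a := by positivity
    rw [norm_mul, Complex.norm_real, Real.norm_of_nonneg hpos, Real.rpow_add hρ0]
    calc 2 * ρ ^ a * ‖h ρ‖ ≤ 2 * ρ ^ a * (M * ρ ^ b) :=
          mul_le_mul_of_nonneg_left (hbound ρ ⟨hρ0, hρ.2⟩) hpos
      _ = 2 * M * (ρ ^ a * ρ ^ b) := by ring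
  have hpow : 0 ≤ r ^ (a + b + 1) := Real.rpow_nonneg hr.1.le _
  calc ‖∫ ρ in r..1, ((2 * ρ ^ a : ℝ) : ℂ) * h ρ‖
      ≤ ∫ ρ in r..1, 2 * M * ρ ^ (a + b) :=
        intervalIntegral.norm_integral_le_of_norm_le hr.2 (Filter.Eventually.of_forall hle)
          ((intervalIntegral.intervalIntegrable_rpow (Or.inr h0)).const_mul _)
    _ = 2 * M * ((1 - r ^ (a + b + 1)) / (a + b + 1)) := by
        rw [intervalIntegral.integral_const_mul,
          integral_rpow (Or.inr ⟨fun hc => hab (by linarith), h0⟩), Real.one_rpow]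
    _ ≤ 2 * M * ((r ^ (a + b + 1) + 1) / |a + b + 1|) := by
        refine mul_le_mul_of_nonneg_left ((le_abs_self _).trans ?_) (by positivity)
        rw [abs_div]
        gcongr
        exact abs_le.2 ⟨by linarith, by linarith⟩
    _ = 2 * M / |a + b + 1| * (r ^ (a + b + 1) + 1) := by ring

/-- Mode-by-mode ODE solution with asymptotic bound (from the proof of Lemma 3.3 of the
paper): for `h` continuous on `(0,1]` with `|h(ρ)| ≤ M ρ^b` and `a + b + 1 ≠ 0`, the
function `g(r) = -r^{-a} ∫_r^1 2 ρ^a h(ρ) dρ` is `C¹` on `(0,1)`, solves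
`g′(r) + (a/r) g(r) = 2 h(r)` there, and satisfies
`|g(r)| ≤ (2M/|a+b+1|) (r^{b+1} + r^{-a})` on `(0,1]`. -/
theorem radial_ode_solution
    (a b M : ℝ) (hab : a + b + 1 ≠ 0) (hM : 0 ≤ M)
    (h : ℝ → ℂ) (hcont : ContinuousOn h (Set.Ioc 0 1))
    (hbound : ∀ ρ ∈ Set.Ioc (0 : ℝ) 1, ‖h ρ‖ ≤ M * ρ ^ b)
    (g : ℝ → ℂ)
    (hg : ∀ r ∈ Set.Ioc (0 : ℝ) 1,
      g r = -((r ^ (-a) : ℝ) : ℂ) * ∫ ρ in r..1, ((2 * ρ ^ a : ℝ) : ℂ) * h ρ) :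
    ContDiffOn ℝ 1 g (Set.Ioo 0 1) ∧
    (∀ r ∈ Set.Ioo (0 : ℝ) 1, deriv g r + ((a / r : ℝ) : ℂ) * g r = 2 * h r) ∧
    (∀ r ∈ Set.Ioc (0 : ℝ) 1,
      ‖g r‖ ≤ (2 * M / |a + b + 1|) * (r ^ (b + 1) + r ^ (-a))) := by
  have hderiv : ∀ r ∈ Set.Ioo (0 : ℝ) 1,
      HasDerivAt g (2 * h r - ((a / r : ℝ) : ℂ) * g r) r := by
    intro r hr
    rw [hg r (Set.Ioo_subset_Ioc_self hr)]
    refine (hasDerivAt_neg_rpow_mul_integral a hcont hr).congr_of_eventuallyEq ?_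
    filter_upwards [isOpen_Ioo.mem_nhds hr] with s hs
    exact hg s (Set.Ioo_subset_Ioc_self hs)
  refine ⟨?_, fun r hr => ?_, fun r hr => ?_⟩
  · have hgcont : ContinuousOn g (Set.Ioo 0 1) :=
      fun r hr => (hderiv r hr).continuousAt.continuousWithinAt
    have hquot : ContinuousOn (fun r : ℝ => ((a / r : ℝ) : ℂ)) (Set.Ioo 0 1) :=
      Complex.continuous_ofReal.comp_continuousOn
        (continuousOn_const.div continuousOn_id fun r hr => hr.1.ne')
    rw [← zero_add (1 : WithTop ℕ∞), contDiffOn_succ_iff_deriv_of_isOpen isOpen_Ioo]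
    refine ⟨fun r hr => (hderiv r hr).differentiableAt.differentiableWithinAt,
      by simp, contDiffOn_zero.2 ?_⟩
    exact ((continuousOn_const.mul (hcont.mono Set.Ioo_subset_Ioc_self)).sub
      (hquot.mul hgcont)).congr fun r hr => (hderiv r hr).deriv
  · rw [(hderiv r hr).deriv, sub_add_cancel]
  · have hpow : 0 ≤ r ^ (-a) := Real.rpow_nonneg hr.1.le _
    rw [hg r hr, norm_mul, norm_neg, Complex.norm_real, Real.norm_of_nonneg hpow]
    calc r ^ (-a) * ‖∫ ρ in r..1, ((2 * ρ ^ a : ℝ) : ℂ) * h ρ‖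
        ≤ r ^ (-a) * (2 * M / |a + b + 1| * (r ^ (a + b + 1) + 1)) :=
          mul_le_mul_of_nonneg_left (norm_integral_two_mul_rpow_mul_le hab hM hbound hr) hpow
      _ = 2 * M / |a + b + 1| * (r ^ (-a) * r ^ (a + b + 1) + r ^ (-a)) := by ring
      _ = 2 * M / |a + b + 1| * (r ^ (b + 1) + r ^ (-a)) := by
          rw [← Real.rpow_add hr.1, show -a + (a + b + 1) = b + 1 by ring]
end
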